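/- Let K, N ≥ 1 be integers, B = K·N, and let m > 0, c ≥ 0, δ ∈ (0,1), θ ∈ (0,1] be real numbers. For α ∈ ℝ^B with nonnegative entries let J(α) denote the number of indices k ∈ {1,…,K} such that α_{N(k-1)+n} ≥ 1−δ for all n = 1,…,N. Then lim_{s→∞} −(1/log s)·log ( ∫_{ℝ_+^B} s^{−m ∑_{b=1}^B α_b} · min{ 1, s^{−c·(K·θ − J(α))} } dα ) = min_{0 ≤ j ≤ K} [ j·m·N·(1−δ) + c·max(K·θ − j, 0) ], the minimum being over integers j, and the integral being with respect to Lebesgue measure on the nonnegative orthant ℝ_+^B. -/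

import Mathlib

open MeasureTheory

/-- The number of groups `k ∈ {1,…,K}` (groups of `N` consecutive coordinates of
`α ∈ ℝ^(K·N)`, group `k` consisting of coordinates `N(k-1)+1, …, Nk`) all of whose
coordinates are at least `c`.  This is `J(α)` for threshold `c = 1 - δ`. -/
noncomputable def deepCount (K N : ℕ) (c : ℝ) (α : Fin (K * N) → ℝ) : ℕ :=
  (Finset.univ.filter fun k : Fin K =>
    ∀ n : Fin N, c ≤ α (finProdFinEquiv (k, n))).card

lemma deepCount_eq_sum (K N : ℕ) (t : ℝ) (α : Fin (K * N) → ℝ) :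
    (deepCount K N t α : ℝ) =
      ∑ k : Fin K, if ∀ n : Fin N, t ≤ α (finProdFinEquiv (k, n)) then (1 : ℝ) else 0 := by
  simp [deepCount]

lemma measurable_deepCount (K N : ℕ) (t : ℝ) :
    Measurable fun α : Fin (K * N) → ℝ => (deepCount K N t α : ℝ) := by
  simp only [deepCount_eq_sum]
  refine Finset.measurable_sum _ fun k _ => Measurable.ite ?_ measurable_const measurable_const
  simp only [Set.ofPred_forall]
  exact MeasurableSet.iInter fun n => measurableSet_le measurable_const (measurable_pi_apply _)

lemma deepCount_le (K N : ℕ) (t : ℝ) (α : Fin (K * N) → ℝ) : deepCount K N t α ≤ K := by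
  simpa [deepCount] using Finset.card_filter_le (Finset.univ : Finset (Fin K))
    fun k => ∀ n : Fin N, t ≤ α (finProdFinEquiv (k, n))

lemma sum_eq_sum_groups {K N : ℕ} (α : Fin (K * N) → ℝ) :
    ∑ b, α b = ∑ k : Fin K, ∑ n : Fin N, α (finProdFinEquiv (k, n)) := by
  rw [← finProdFinEquiv.sum_comp, Fintype.sum_prod_type]

lemma deepCount_mul_le_sum {K N : ℕ} {t : ℝ} {α : Fin (K * N) → ℝ} (hα : ∀ b, 0 ≤ α b) :
    (deepCount K N t α : ℝ) * (N * t) ≤ ∑ b, α b := by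
  rw [deepCount_eq_sum, sum_eq_sum_groups, Finset.sum_mul]
  refine Finset.sum_le_sum fun k _ => ?_
  split_ifs with h
  · simpa using Finset.sum_le_sum fun (n : Fin N) (_ : n ∈ Finset.univ) => h n
  · simpa using Finset.sum_nonneg fun (n : Fin N) _ => hα (finProdFinEquiv (k, n))

/-- The point whose first `j` groups have all coordinates `t`, the others being zero. -/
noncomputable def deepCorner (K N : ℕ) (t : ℝ) (j : ℕ) (b : Fin (K * N)) : ℝ :=
  if ((finProdFinEquiv.symm b).1 : ℕ) < j then t else 0

lemma deepCorner_nonneg {K N : ℕ} {t : ℝ} (ht : 0 ≤ t) (j : ℕ) (b : Fin (K * N)) :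
    0 ≤ deepCorner K N t j b := by
  unfold deepCorner
  split_ifs <;> simp [ht]

lemma card_filter_val_lt {K j : ℕ} (hj : j ≤ K) :
    (Finset.univ.filter fun k : Fin K => (k : ℕ) < j).card = j := by
  rw [Fin.card_filter_val_lt, min_eq_right hj]

lemma sum_deepCorner {K N : ℕ} (t : ℝ) {j : ℕ} (hj : j ≤ K) :
    ∑ b, deepCorner K N t j b = j * (N * t) := by
  rw [sum_eq_sum_groups]
  simp only [deepCorner, Equiv.symm_apply_apply, Finset.sum_const, Finset.card_univ,
    Fintype.card_fin, nsmul_eq_mul, mul_ite, mul_zero]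
  rw [← Finset.sum_filter, Finset.sum_const, card_filter_val_lt hj, nsmul_eq_mul]

lemma le_deepCount_of_deepCorner_le {K N : ℕ} {t : ℝ} {j : ℕ} (hj : j ≤ K)
    {α : Fin (K * N) → ℝ} (h : ∀ b, deepCorner K N t j b ≤ α b) : j ≤ deepCount K N t α := by
  rw [← card_filter_val_lt hj]
  refine Finset.card_le_card fun k hk => ?_
  simp only [Finset.mem_filter, Finset.mem_univ, true_and] at hk ⊢
  intro n
  simpa [deepCorner, hk] using h (finProdFinEquiv (k, n))

lemma setOf_nonneg_eq_pi (ι : Type*) :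
    {α : ι → ℝ | ∀ b, 0 ≤ α b} = Set.univ.pi fun _ => Set.Ici 0 := by
  ext; simp [Pi.le_def]

lemma integrableOn_exp_neg_mul_sum {ι : Type*} [Fintype ι] {m : ℝ} (hm : 0 < m) :
    IntegrableOn (fun α : ι → ℝ => Real.exp (-(m * ∑ b, α b))) {α | ∀ b, 0 ≤ α b} := by
  have h : Integrable (fun x : ℝ => Real.exp (-m * x)) (volume.restrict (Set.Ici 0)) :=
    (integrableOn_Ici_iff_integrableOn_Ioi).mpr (exp_neg_integrableOn_Ioi 0 hm)
  rw [setOf_nonneg_eq_pi, IntegrableOn, volume_pi, Measure.restrict_pi_pi]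
  refine (Integrable.fintype_prod fun _ : ι => h).congr (.of_forall fun α => ?_)
  simp only [← Real.exp_sum, Finset.mul_sum, neg_mul, Finset.sum_neg_distrib]

lemma volume_real_pi_Icc_add {ι : Type*} [Fintype ι] (a : ι → ℝ) {r : ℝ} (hr : 0 ≤ r) :
    volume.real (Set.Icc a fun b => a b + r) = r ^ Fintype.card ι := by
  rw [measureReal_def, Real.volume_Icc_pi_toReal fun b => by simpa using hr]
  simp

/-- **Laplace's method** for an exponent `g` bounded below by `E`, dominated from below by an
`exp (-·)`-integrable `w`, and at most `E + A / L` on sets of measure at least `L ^ (-d)`. -/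
lemma tendsto_laplace {Ω : Type*} [MeasurableSpace Ω] {μ : Measure Ω} {g w : Ω → ℝ}
    {E A : ℝ} {d : ℕ} (hg : AEStronglyMeasurable g μ) (hw : Integrable (fun x => Real.exp (-w x)) μ)
    (hwg : ∀ᵐ x ∂μ, w x ≤ g x) (hEg : ∀ᵐ x ∂μ, E ≤ g x)
    (hbox : ∀ L : ℝ, 1 ≤ L → ∃ T, MeasurableSet T ∧ μ T ≠ ⊤ ∧ (L⁻¹) ^ d ≤ μ.real T ∧
      ∀ x ∈ T, g x ≤ E + A / L) :
    Filter.Tendsto (fun L : ℝ => -(1 / L) * Real.log (∫ x, Real.exp (-(L * g x)) ∂μ))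
      Filter.atTop (nhds E) := by
  set C := (∫ x, Real.exp (-w x) ∂μ) + 1
  have hC : 0 < C := by
    have : 0 ≤ ∫ x, Real.exp (-w x) ∂μ := integral_nonneg fun x => (Real.exp_pos _).le
    positivity
  have hdom : ∀ L : ℝ, 1 ≤ L → ∀ᵐ x ∂μ,
      Real.exp (-(L * g x)) ≤ Real.exp (-((L - 1) * E)) * Real.exp (-w x) := by
    intro L hL
    filter_upwards [hwg, hEg] with x h1 h2
    rw [← Real.exp_add, Real.exp_le_exp]
    nlinarith [mul_le_mul_of_nonneg_left h2 (sub_nonneg.mpr hL)]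
  have hint : ∀ L : ℝ, 1 ≤ L → Integrable (fun x => Real.exp (-(L * g x))) μ := by
    intro L hL
    refine (hw.const_mul (Real.exp (-((L - 1) * E)))).mono'
      (Real.continuous_exp.comp_aestronglyMeasurable (hg.const_mul L).neg) ?_
    filter_upwards [hdom L hL] with x hx
    rwa [Real.norm_eq_abs, Real.abs_exp]
  have hupper : ∀ L : ℝ, 1 ≤ L →
      ∫ x, Real.exp (-(L * g x)) ∂μ ≤ Real.exp (-((L - 1) * E)) * C := by
    intro L hL
    refine (integral_mono_ae (hint L hL) (hw.const_mul _) (hdom L hL)).trans ?_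
    rw [integral_const_mul]
    gcongr
    exact le_add_of_nonneg_right zero_le_one
  have hlower : ∀ L : ℝ, 1 ≤ L →
      (L⁻¹) ^ d * Real.exp (-(L * E + A)) ≤ ∫ x, Real.exp (-(L * g x)) ∂μ := by
    intro L hL
    have hL0 : 0 < L := by linarith
    obtain ⟨T, hT, hfin, hvol, hgT⟩ := hbox L hL
    calc (L⁻¹) ^ d * Real.exp (-(L * E + A))
        ≤ μ.real T * Real.exp (-(L * E + A)) := by gcongr
      _ = ∫ _ in T, Real.exp (-(L * E + A)) ∂μ := by simp
      _ ≤ ∫ x in T, Real.exp (-(L * g x)) ∂μ := by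
          refine setIntegral_mono_on (integrableOn_const hfin) (hint L hL).integrableOn hT
            fun x hx => Real.exp_le_exp.mpr (neg_le_neg ?_)
          calc L * g x ≤ L * (E + A / L) := by gcongr; exact hgT x hx
            _ = L * E + A := by field_simp
      _ ≤ _ := setIntegral_le_integral (hint L hL) (.of_forall fun x => (Real.exp_pos _).le)
  have hinv : Filter.Tendsto (fun L : ℝ => L⁻¹) Filter.atTop (nhds 0) := tendsto_inv_atTop_zero
  have hlog : Filter.Tendsto (fun L : ℝ => Real.log L / L) Filter.atTop (nhds 0) :=
    Real.isLittleO_log_id_atTop.tendsto_div_nhds_zero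
  have hlo : Filter.Tendsto (fun L : ℝ => E - (E + Real.log C) * L⁻¹) Filter.atTop (nhds E) := by
    simpa using (hinv.const_mul (E + Real.log C)).const_sub E
  have hhi : Filter.Tendsto (fun L : ℝ => E + A * L⁻¹ + d * (Real.log L / L))
      Filter.atTop (nhds E) := by
    simpa using ((hinv.const_mul A).const_add E).add (hlog.const_mul (d : ℝ))
  refine tendsto_of_tendsto_of_tendsto_of_le_of_le' hlo hhi ?_ ?_
  all_goals
    filter_upwards [Filter.eventually_ge_atTop 1] with L hL
    have hL0 : 0 < L := by linarith
    have hpos : 0 < (L⁻¹) ^ d * Real.exp (-(L * E + A)) := by positivity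
  · have h := Real.log_le_log (hpos.trans_le (hlower L hL)) (hupper L hL)
    rw [Real.log_mul (Real.exp_ne_zero _) hC.ne', Real.log_exp] at h
    calc E - (E + Real.log C) * L⁻¹ = -(1 / L) * (-((L - 1) * E) + Real.log C) := by
          field_simp; ring
      _ ≤ _ := mul_le_mul_of_nonpos_left h (by simpa using hL0.le)
  · have h := Real.log_le_log hpos (hlower L hL)
    rw [Real.log_mul (by positivity) (Real.exp_ne_zero _), Real.log_exp, Real.log_pow,
      Real.log_inv] at h
    calc _ ≤ -(1 / L) * (d * -Real.log L + -(L * E + A)) :=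
          mul_le_mul_of_nonpos_left h (by simpa using hL0.le)
      _ = _ := by field_simp; ring

lemma rpow_mul_min_one_rpow {s : ℝ} (hs : 1 ≤ s) (x c y : ℝ) (hc : 0 ≤ c) :
    s ^ (-x) * min 1 (s ^ (-(c * y))) = Real.exp (-(Real.log s * (x + c * max y 0))) := by
  have hs0 : 0 < s := by linarith
  have hmin : min 1 (s ^ (-(c * y))) = s ^ (-(c * max y 0)) := by
    rcases le_total y 0 with hy | hy
    · rw [max_eq_right hy, mul_zero, neg_zero, Real.rpow_zero, min_eq_left]
      exact Real.one_le_rpow hs (by nlinarith)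
    · rw [max_eq_left hy, min_eq_right]
      exact Real.rpow_le_one_of_one_le_of_nonpos hs (by nlinarith)
  rw [hmin, ← Real.rpow_add hs0, Real.rpow_def_of_pos hs0]
  ring_nf

/-- **Random coding SNR exponent for coded modulation over K rotations of
dimension N.**  For `B = K·N`, `m > 0`, `c ≥ 0`, `δ ∈ (0,1)` and `θ ∈ (0,1]`,
`lim_{s→∞} -(1/log s)·log ∫_{ℝ₊^B} s^{-m ∑_b α_b} · min{1, s^{-c(Kθ - J(α))}} dα
  = min_{0 ≤ j ≤ K} [ j·m·N·(1-δ) + c·max(Kθ - j, 0) ]`. -/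
theorem random_coding_snr_exponent
    (K N : ℕ) (hK : 1 ≤ K) (hN : 1 ≤ N)
    (m c δ θ : ℝ) (hm : 0 < m) (hc : 0 ≤ c)
    (hδ0 : 0 < δ) (hδ1 : δ < 1) (hθ0 : 0 < θ) (hθ1 : θ ≤ 1) :
    Filter.Tendsto (fun s : ℝ =>
        -(1 / Real.log s) * Real.log
          (∫ α in {α : Fin (K * N) → ℝ | ∀ b, 0 ≤ α b},
            s ^ (-(m * ∑ b, α b)) *
              min 1 (s ^ (-(c * ((K : ℝ) * θ - (deepCount K N (1 - δ) α : ℝ)))))))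
      Filter.atTop
      (nhds ((Finset.range (K + 1)).inf'
        (Finset.nonempty_range_iff.mpr (Nat.succ_ne_zero K))
        (fun j => (j : ℝ) * (m * N * (1 - δ)) + c * max ((K : ℝ) * θ - j) 0))) := by
  set F : ℕ → ℝ := fun j => (j : ℝ) * (m * N * (1 - δ)) + c * max ((K : ℝ) * θ - j) 0 with hF
  have hne : (Finset.range (K + 1)).Nonempty :=
    Finset.nonempty_range_iff.mpr (Nat.succ_ne_zero K)
  set g : (Fin (K * N) → ℝ) → ℝ := fun α =>
    m * ∑ b, α b + c * max ((K : ℝ) * θ - (deepCount K N (1 - δ) α : ℝ)) 0 with hg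
  have hS : MeasurableSet {α : Fin (K * N) → ℝ | ∀ b, 0 ≤ α b} := by
    rw [setOf_nonneg_eq_pi]
    exact MeasurableSet.univ_pi fun _ => measurableSet_Ici
  have hgm : Measurable g := by
    have := measurable_deepCount K N (1 - δ)
    fun_prop
  obtain ⟨j, hj, hjE⟩ := Finset.exists_mem_eq_inf' hne F
  have hjK : j ≤ K := Nat.lt_succ_iff.mp (Finset.mem_range.mp hj)
  have ht : 0 ≤ 1 - δ := by linarith
  have key := tendsto_laplace (μ := volume.restrict {α : Fin (K * N) → ℝ | ∀ b, 0 ≤ α b})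
    (g := g) (E := (Finset.range (K + 1)).inf' hne F) (A := m * (K * N : ℕ)) (d := K * N)
    hgm.aestronglyMeasurable (integrableOn_exp_neg_mul_sum hm)
    (.of_forall fun α => le_add_of_nonneg_right (by positivity))
    ((ae_restrict_mem hS).mono fun α hα => by
      refine (Finset.inf'_le F (Finset.mem_range.mpr
        (Nat.lt_succ_iff.mpr (deepCount_le K N (1 - δ) α)))).trans ?_
      have := mul_le_mul_of_nonneg_left (deepCount_mul_le_sum (t := 1 - δ) hα) hm.le
      simp only [hF, hg]
      linarith)
    (fun L hL => by
      have hL0 : 0 < L := by linarith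
      set a := deepCorner K N (1 - δ) j
      have hsub : Set.Icc a (fun b => a b + L⁻¹) ⊆ {α | ∀ b, 0 ≤ α b} :=
        fun α hα b => (deepCorner_nonneg ht j b).trans (hα.1 b)
      have hvol : (volume.restrict {α : Fin (K * N) → ℝ | ∀ b, 0 ≤ α b})
          (Set.Icc a (fun b => a b + L⁻¹)) = volume (Set.Icc a (fun b => a b + L⁻¹)) :=
        Measure.restrict_eq_self _ hsub
      refine ⟨Set.Icc a (fun b => a b + L⁻¹), measurableSet_Icc, ?_, ?_, ?_⟩
      · rw [hvol]
        exact isCompact_Icc.measure_ne_top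
      · rw [measureReal_def, hvol, ← measureReal_def,
          volume_real_pi_Icc_add a (inv_nonneg.mpr hL0.le), Fintype.card_fin]
      · intro α hα
        have hsum : ∑ b, α b ≤ j * (N * (1 - δ)) + (K * N : ℕ) * L⁻¹ := by
          refine (Finset.sum_le_sum fun b _ => hα.2 b).trans_eq ?_
          rw [Finset.sum_add_distrib, sum_deepCorner _ hjK]
          simp
        have hcount : (j : ℝ) ≤ deepCount K N (1 - δ) α :=
          Nat.cast_le.mpr (le_deepCount_of_deepCorner_le hjK hα.1)
        rw [hjE]
        calc g α ≤ m * (j * (N * (1 - δ)) + (K * N : ℕ) * L⁻¹)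
              + c * max ((K : ℝ) * θ - j) 0 := by
              simp only [hg]
              gcongr
          _ = F j + m * (K * N : ℕ) / L := by
              simp only [hF]
              ring)
  refine (key.comp Real.tendsto_log_atTop).congr' ?_
  filter_upwards [Filter.eventually_ge_atTop 1] with s hs
  simp only [Function.comp_apply, hg, rpow_mul_min_one_rpow hs _ c _ hc]
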